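/- arXiv:1601.07744 — 3 statements merged into one kernel-verified Lean document; each statement's English description precedes it below -/
import Mathlib

section
/- Let λ, μ ∈ ℝ with μ > 0 and λ + μ > 0, set α := (λ+μ)/(λ+3μ), let 0 < R < q, let k ≥ 3 be an integer, and set c₁ := α(R² − q²)/q⁴. Define v^{(e)} : ℝ² \ {0} → ℝ² in polar coordinates by v^{(e)}(x) = (q/R)^{2k} [ ( r^{−k} cos(kθ), r^{−k} sin(kθ) ) + c₁ k ( (k−2)α(r²−q²) r^{−k} cos(kθ) + r^{−(k−2)} cos((k−2)θ), (k−2)α(r²−q²) r^{−k} sin(kθ) − r^{−(k−2)} sin((k−2)θ) ) ]. Then μ Δv^{(e)} + (λ+μ)∇(∇·v^{(e)}) = 0 at every point of ℝ² \ {0}. -/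
open Real MeasureTheory

noncomputable section

/-- Partial derivative in the first coordinate direction. -/
def pdx (f : ℝ × ℝ → ℝ) (x : ℝ × ℝ) : ℝ := fderiv ℝ f x (1, 0)

/-- Partial derivative in the second coordinate direction. -/
def pdy (f : ℝ × ℝ → ℝ) (x : ℝ × ℝ) : ℝ := fderiv ℝ f x (0, 1)

/-- Divergence of a planar vector field. -/
def div2 (u : ℝ × ℝ → ℝ × ℝ) (x : ℝ × ℝ) : ℝ :=
  pdx (fun y => (u y).1) x + pdy (fun y => (u y).2) x

/-- Componentwise Laplacian. -/
def lap2 (f : ℝ × ℝ → ℝ) (x : ℝ × ℝ) : ℝ :=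
  pdx (fun y => pdx f y) x + pdy (fun y => pdy f y) x

/-- The Lamé operator  μ Δu + (λ+μ) ∇(∇·u). -/
def lame2 (lam mu : ℝ) (u : ℝ × ℝ → ℝ × ℝ) (x : ℝ × ℝ) : ℝ × ℝ :=
  (mu * lap2 (fun y => (u y).1) x + (lam + mu) * pdx (fun y => div2 u y) x,
   mu * lap2 (fun y => (u y).2) x + (lam + mu) * pdy (fun y => div2 u y) x)

/-- Conormal derivative  λ(∇·u)ν + μ(∇u + (∇u)ᵀ)ν. -/
def trac (lam mu : ℝ) (u : ℝ × ℝ → ℝ × ℝ) (x ν : ℝ × ℝ) : ℝ × ℝ :=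
  (lam * div2 u x * ν.1
      + mu * (2 * pdx (fun y => (u y).1) x * ν.1
        + (pdy (fun y => (u y).1) x + pdx (fun y => (u y).2) x) * ν.2),
   lam * div2 u x * ν.2
      + mu * ((pdy (fun y => (u y).1) x + pdx (fun y => (u y).2) x) * ν.1
        + 2 * pdy (fun y => (u y).2) x * ν.2))

/-- Entries of the symmetric gradient ∇ˢu = (∇u + (∇u)ᵀ)/2. -/
def sg11 (u : ℝ × ℝ → ℝ × ℝ) (x : ℝ × ℝ) : ℝ := pdx (fun y => (u y).1) x

def sg12 (u : ℝ × ℝ → ℝ × ℝ) (x : ℝ × ℝ) : ℝ :=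
  (pdy (fun y => (u y).1) x + pdx (fun y => (u y).2) x) / 2

def sg22 (u : ℝ × ℝ → ℝ × ℝ) (x : ℝ × ℝ) : ℝ := pdy (fun y => (u y).2) x

/-- Frobenius inner product ∇ˢu : ∇ˢv of the symmetric gradients of two fields. -/
def sgFrob (u v : ℝ × ℝ → ℝ × ℝ) (x : ℝ × ℝ) : ℝ :=
  sg11 u x * sg11 v x + 2 * (sg12 u x * sg12 v x) + sg22 u x * sg22 v x

/-- Euclidean norm on ℝ². -/
def nr (x : ℝ × ℝ) : ℝ := Real.sqrt (x.1 ^ 2 + x.2 ^ 2)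

/-- The scalar field `f` has total derivative `(v₁, v₂) ↦ a v₁ + b v₂` at `x`. -/
def HasGrad2 (f : ℝ × ℝ → ℝ) (a b : ℝ) (x : ℝ × ℝ) : Prop :=
  HasFDerivAt f (a • ContinuousLinearMap.fst ℝ ℝ ℝ + b • ContinuousLinearMap.snd ℝ ℝ ℝ) x

namespace HasGrad2

variable {f g : ℝ × ℝ → ℝ} {a b c d : ℝ} {x : ℝ × ℝ}

theorem pdx_eq (h : HasGrad2 f a b x) : pdx f x = a := by
  simp [pdx, HasFDerivAt.fderiv h]

theorem pdy_eq (h : HasGrad2 f a b x) : pdy f x = b := by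
  simp [pdy, HasFDerivAt.fderiv h]

theorem congr_coeff (h : HasGrad2 f a b x) (ha : a = c) (hb : b = d) : HasGrad2 f c d x := by
  subst ha hb
  exact h

theorem congr_of_ne_zero (h : HasGrad2 f a b x) (hx : x ≠ 0) (hfg : ∀ y, y ≠ 0 → g y = f y) :
    HasGrad2 g a b x :=
  HasFDerivAt.congr_of_eventuallyEq h <| by
    filter_upwards [isOpen_ne.mem_nhds hx] with y hy using hfg y hy

theorem add (hf : HasGrad2 f a b x) (hg : HasGrad2 g c d x) :
    HasGrad2 (fun y => f y + g y) (a + c) (b + d) x := by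
  refine (HasFDerivAt.add hf hg).congr_fderiv ?_
  ext <;> simp

theorem mul (hf : HasGrad2 f a b x) (hg : HasGrad2 g c d x) :
    HasGrad2 (fun y => f y * g y) (a * g x + f x * c) (b * g x + f x * d) x := by
  refine (HasFDerivAt.mul hf hg).congr_fderiv ?_
  ext <;> simp <;> ring

theorem const_mul (hf : HasGrad2 f a b x) (r : ℝ) :
    HasGrad2 (fun y => r * f y) (r * a) (r * b) x := by
  refine (HasFDerivAt.const_mul hf r).congr_fderiv ?_
  ext <;> simp

theorem fst : HasGrad2 (fun y => y.1) 1 0 x := by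
  refine (hasFDerivAt_fst (𝕜 := ℝ)).congr_fderiv ?_
  ext <;> simp

theorem snd : HasGrad2 (fun y => y.2) 0 1 x := by
  refine (hasFDerivAt_snd (𝕜 := ℝ)).congr_fderiv ?_
  ext <;> simp

theorem affine_normSq (s t : ℝ) :
    HasGrad2 (fun y => s + t * (y.1 ^ 2 + y.2 ^ 2)) (2 * t * x.1) (2 * t * x.2) x := by
  have h := (((fst (x := x)).mul fst).add ((snd (x := x)).mul snd)).const_mul t
  refine (HasFDerivAt.const_add s
    (h.congr_coeff (c := 2 * t * x.1) (d := 2 * t * x.2) (by ring) (by ring))).congr_of_eventuallyEq ?_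
  filter_upwards with y
  ring

end HasGrad2

/-- The Lamé operator computed from explicit first and second derivatives. -/
theorem lame2_eq_of_hasGrad2 (lam mu : ℝ) {u : ℝ × ℝ → ℝ × ℝ} {a b c d : ℝ × ℝ → ℝ}
    {a₁ a₂ b₁ b₂ c₁ c₂ d₁ d₂ : ℝ} {x : ℝ × ℝ} (hx : x ≠ 0)
    (h₁ : ∀ y, y ≠ 0 → HasGrad2 (fun y => (u y).1) (a y) (b y) y)
    (h₂ : ∀ y, y ≠ 0 → HasGrad2 (fun y => (u y).2) (c y) (d y) y)
    (ha : HasGrad2 a a₁ a₂ x) (hb : HasGrad2 b b₁ b₂ x)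
    (hc : HasGrad2 c c₁ c₂ x) (hd : HasGrad2 d d₁ d₂ x) :
    lame2 lam mu u x = (mu * (a₁ + b₂) + (lam + mu) * (a₁ + d₁),
      mu * (c₁ + d₂) + (lam + mu) * (a₂ + d₂)) := by
  have hdiv : HasGrad2 (fun y => div2 u y) (a₁ + d₁) (a₂ + d₂) x :=
    (ha.add hd).congr_of_ne_zero hx fun y hy => by
      simp only [div2, (h₁ y hy).pdx_eq, (h₂ y hy).pdy_eq]
  simp only [lame2, lap2, hdiv.pdx_eq, hdiv.pdy_eq,
    (ha.congr_of_ne_zero hx fun y hy => (h₁ y hy).pdx_eq).pdx_eq,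
    (hb.congr_of_ne_zero hx fun y hy => (h₁ y hy).pdy_eq).pdy_eq,
    (hc.congr_of_ne_zero hx fun y hy => (h₂ y hy).pdx_eq).pdx_eq,
    (hd.congr_of_ne_zero hx fun y hy => (h₂ y hy).pdy_eq).pdy_eq]

/-- The plane point `x` as a complex number. -/
def toComplex (x : ℝ × ℝ) : ℂ := ⟨x.1, x.2⟩

theorem toComplex_ne_zero {x : ℝ × ℝ} (hx : x ≠ 0) : toComplex x ≠ 0 := fun h =>
  hx (Prod.ext (congrArg Complex.re h) (congrArg Complex.im h))

/-- Real part of `z⁻ⁿ`. -/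
def invPowRe (n : ℕ) (x : ℝ × ℝ) : ℝ := ((toComplex x)⁻¹ ^ n).re

/-- Imaginary part of `z⁻ⁿ`. -/
def invPowIm (n : ℕ) (x : ℝ × ℝ) : ℝ := ((toComplex x)⁻¹ ^ n).im

theorem invPow_eq_mul_succ {x : ℝ × ℝ} (hx : x ≠ 0) (n : ℕ) :
    (toComplex x)⁻¹ ^ n = toComplex x * (toComplex x)⁻¹ ^ (n + 1) := by
  rw [pow_succ', mul_inv_cancel_left₀ (toComplex_ne_zero hx)]

theorem invPowRe_eq {x : ℝ × ℝ} (hx : x ≠ 0) (n : ℕ) :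
    invPowRe n x = x.1 * invPowRe (n + 1) x - x.2 * invPowIm (n + 1) x := by
  rw [invPowRe, invPow_eq_mul_succ hx, Complex.mul_re]
  rfl

theorem invPowIm_eq {x : ℝ × ℝ} (hx : x ≠ 0) (n : ℕ) :
    invPowIm n x = x.1 * invPowIm (n + 1) x + x.2 * invPowRe (n + 1) x := by
  rw [invPowIm, invPow_eq_mul_succ hx, Complex.mul_im]
  rfl

theorem invPow_polar (r θ : ℝ) (n : ℕ) :
    (toComplex (r * cos θ, r * sin θ))⁻¹ ^ n
      = ⟨cos (n * θ) / r ^ n, -(sin (n * θ) / r ^ n)⟩ := by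
  have hz : toComplex (r * cos θ, r * sin θ) = r * Complex.exp (θ * Complex.I) := by
    apply Complex.ext <;>
      simp [toComplex, Complex.exp_ofReal_mul_I_re, Complex.exp_ofReal_mul_I_im]
  have hw : (toComplex (r * cos θ, r * sin θ))⁻¹ ^ n
      = ((r ^ n)⁻¹ : ℝ) * Complex.exp ((-(n * θ) : ℝ) * Complex.I) := by
    rw [hz, mul_inv, mul_pow, ← Complex.exp_neg, ← Complex.exp_nat_mul]
    push_cast
    rw [inv_pow]
    congr 2
    ring
  rw [hw]
  apply Complex.ext
  · rw [Complex.re_ofReal_mul, Complex.exp_ofReal_mul_I_re, cos_neg]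
    ring
  · rw [Complex.im_ofReal_mul, Complex.exp_ofReal_mul_I_im, sin_neg]
    ring

theorem hasFDerivAt_invPow {x : ℝ × ℝ} (hx : x ≠ 0) (n : ℕ) :
    HasFDerivAt (fun y => (toComplex y)⁻¹ ^ n)
      ((-(n : ℂ) * (toComplex x)⁻¹ ^ (n + 1)) •
        (Complex.equivRealProdCLM.symm : ℝ × ℝ →L[ℝ] ℂ)) x := by
  have hz := toComplex_ne_zero hx
  have h₁ : HasFDerivAt toComplex (Complex.equivRealProdCLM.symm : ℝ × ℝ →L[ℝ] ℂ) x := by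
    refine (Complex.equivRealProdCLM.symm.hasFDerivAt (x := x)).congr_of_eventuallyEq ?_
    filter_upwards with y
    apply Complex.ext <;> simp [toComplex]
  have h₂ : HasDerivAt (fun w : ℂ => w⁻¹ ^ n)
      (-(n : ℂ) * (toComplex x)⁻¹ ^ (n + 1)) (toComplex x) := by
    refine ((hasDerivAt_inv hz).pow n).congr_deriv ?_
    cases n with
    | zero => simp
    | succ m =>
      simp only [Nat.add_sub_cancel, pow_succ, inv_pow]
      field_simp
  exact h₂.comp_hasFDerivAt x h₁

theorem hasGrad2_invPowRe {x : ℝ × ℝ} (hx : x ≠ 0) (n : ℕ) :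
    HasGrad2 (invPowRe n) (-n * invPowRe (n + 1) x) (n * invPowIm (n + 1) x) x := by
  refine (Complex.reCLM.hasFDerivAt.comp x (hasFDerivAt_invPow hx n)).congr_fderiv ?_
  ext <;> simp [invPowRe, invPowIm]

theorem hasGrad2_invPowIm {x : ℝ × ℝ} (hx : x ≠ 0) (n : ℕ) :
    HasGrad2 (invPowIm n) (-n * invPowIm (n + 1) x) (-n * invPowRe (n + 1) x) x := by
  refine (Complex.imCLM.hasFDerivAt.comp x (hasFDerivAt_invPow hx n)).congr_fderiv ?_
  ext <;> simp [invPowRe, invPowIm]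

/-- In complex notation, `A ((s + t z z̄) z̄⁻ᵏ + w z^{-(k-2)})` with `k = m + 2` solves the Lamé
system when `(λ + 3 μ) t = (λ + μ) m w`. -/
theorem lame2_eq_zero_of_invPow {lam mu A s t w : ℝ} {m : ℕ} {u : ℝ × ℝ → ℝ × ℝ}
    (ht : (lam + 3 * mu) * t = (lam + mu) * (m * w))
    (hu₁ : ∀ y, y ≠ 0 → (u y).1 =
      A * ((s + t * (y.1 ^ 2 + y.2 ^ 2)) * invPowRe (m + 2) y + w * invPowRe m y))
    (hu₂ : ∀ y, y ≠ 0 → (u y).2 =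
      A * ((s + t * (y.1 ^ 2 + y.2 ^ 2)) * (-1 * invPowIm (m + 2) y) + w * invPowIm m y))
    {x : ℝ × ℝ} (hx : x ≠ 0) : lame2 lam mu u x = (0, 0) := by
  have hρ (y : ℝ × ℝ) := HasGrad2.affine_normSq (x := y) s t
  have hX := (HasGrad2.fst (x := x)).const_mul (2 * t)
  have hY := (HasGrad2.snd (x := x)).const_mul (2 * t)
  have hP (n : ℕ) := hasGrad2_invPowRe hx n
  have hQ (n : ℕ) := hasGrad2_invPowIm hx n
  rw [lame2_eq_of_hasGrad2 lam mu hx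
    (fun y hy => HasGrad2.congr_of_ne_zero ((((hρ y).mul (hasGrad2_invPowRe hy (m + 2))).add
      ((hasGrad2_invPowRe hy m).const_mul w)).const_mul A) hy hu₁)
    (fun y hy => HasGrad2.congr_of_ne_zero ((((hρ y).mul
      ((hasGrad2_invPowIm hy (m + 2)).const_mul (-1))).add
      ((hasGrad2_invPowIm hy m).const_mul w)).const_mul A) hy hu₂)
    (((hX.mul (hP _)).add ((hρ x).mul ((hP _).const_mul _))).add
      (((hP _).const_mul _).const_mul w) |>.const_mul A)
    (((hY.mul (hP _)).add ((hρ x).mul ((hQ _).const_mul _))).add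
      (((hQ _).const_mul _).const_mul w) |>.const_mul A)
    (((hX.mul ((hQ _).const_mul _)).add ((hρ x).mul (((hQ _).const_mul _).const_mul _))).add
      (((hQ _).const_mul _).const_mul w) |>.const_mul A)
    (((hY.mul ((hQ _).const_mul _)).add ((hρ x).mul (((hP _).const_mul _).const_mul _))).add
      (((hP _).const_mul _).const_mul w) |>.const_mul A)]
  simp only [invPowRe_eq hx (m + 2), invPowIm_eq hx (m + 2), invPowRe_eq hx (m + 2 + 1),
    invPowIm_eq hx (m + 2 + 1), add_assoc, Nat.reduceAdd]
  push_cast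
  generalize invPowRe (m + 4) x = p
  generalize invPowIm (m + 4) x = r
  refine Prod.ext ?_ ?_
  · linear_combination (-2 * A * (m + 1) * ((x.1 ^ 2 - x.2 ^ 2) * p - 2 * x.1 * x.2 * r)) * ht
  · linear_combination (2 * A * (m + 1) * ((x.1 ^ 2 - x.2 ^ 2) * r + 2 * x.1 * x.2 * p)) * ht

/-- the exterior part v^{(e)} of the low-frequency test field v̂_k satisfies the
Lamé equation μΔv^{(e)} + (λ+μ)∇(∇·v^{(e)}) = 0 on ℝ² \ {0}. -/
theorem exterior_test_field_satisfies_lame (lam mu : ℝ) (hmu : 0 < mu)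
    (hlm : 0 < lam + mu) (α : ℝ) (hα : α = (lam + mu) / (lam + 3 * mu))
    (R q : ℝ) (hR : 0 < R) (hq : R < q) (k : ℕ) (hk : 3 ≤ k)
    (c₁ : ℝ) (hc₁ : c₁ = α * (R ^ 2 - q ^ 2) / q ^ 4)
    (ve : ℝ × ℝ → ℝ × ℝ)
    (hve : ∀ r θ : ℝ, 0 < r →
      ve (r * Real.cos θ, r * Real.sin θ)
        = ((q / R) ^ (2 * k) * (Real.cos ((k : ℝ) * θ) / r ^ k
              + c₁ * (k : ℝ) * (((k : ℝ) - 2) * α * (r ^ 2 - q ^ 2) * Real.cos ((k : ℝ) * θ) / r ^ k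
                + Real.cos (((k : ℝ) - 2) * θ) / r ^ (k - 2))),
           (q / R) ^ (2 * k) * (Real.sin ((k : ℝ) * θ) / r ^ k
              + c₁ * (k : ℝ) * (((k : ℝ) - 2) * α * (r ^ 2 - q ^ 2) * Real.sin ((k : ℝ) * θ) / r ^ k
                - Real.sin (((k : ℝ) - 2) * θ) / r ^ (k - 2))))) :
    ∀ x : ℝ × ℝ, x ≠ 0 → lame2 lam mu ve x = (0, 0) := by
  obtain ⟨m, rfl⟩ : ∃ m, k = m + 2 := ⟨k - 2, by omega⟩
  have hden : lam + 3 * mu ≠ 0 := by linarith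
  have polar (y : ℝ × ℝ) (hy : y ≠ 0) :
      ∃ r θ : ℝ, 0 < r ∧ y = (r * cos θ, r * sin θ) :=
    ⟨‖toComplex y‖, (toComplex y).arg, norm_pos_iff.2 (toComplex_ne_zero hy),
      Prod.ext (Complex.norm_mul_cos_arg (toComplex y)).symm
        (Complex.norm_mul_sin_arg (toComplex y)).symm⟩
  have hsq (r θ : ℝ) : (r * cos θ) ^ 2 + (r * sin θ) ^ 2 = r ^ 2 := by
    linear_combination r ^ 2 * cos_sq_add_sin_sq θ
  have hm : ((m + 2 : ℕ) : ℝ) - 2 = m := by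
    push_cast
    ring
  intro x hx
  refine lame2_eq_zero_of_invPow (A := (q / R) ^ (2 * (m + 2)))
    (s := 1 - c₁ * (m + 2 : ℕ) * m * α * q ^ 2) (t := c₁ * (m + 2 : ℕ) * m * α)
    (w := c₁ * (m + 2 : ℕ)) (m := m) ?_ ?_ ?_ hx
  · rw [hα]
    field_simp
  · intro y hy
    obtain ⟨r, θ, hr, rfl⟩ := polar y hy
    simp only [hve r θ hr, hm, Nat.add_sub_cancel, hsq, invPowRe, invPow_polar]
    ring
  · intro y hy
    obtain ⟨r, θ, hr, rfl⟩ := polar y hy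
    simp only [hve r θ hr, hm, Nat.add_sub_cancel, hsq, invPowIm, invPow_polar]
    ring
end
end

section
/- Let λ, μ ∈ ℝ with μ > 0 and λ + μ > 0, set α := (λ+μ)/(λ+3μ), let 0 < R < q, let k ≥ 3 be an integer, and set c₁ := α(R²−q²)/q⁴ and c₂ := 4μ(λ+2μ)/(q³(λ+3μ)²). Define in polar coordinates v^{(f)}(x) := R^{−2k} ( r^k cos(kθ) − kα(r²−R²) r^{k−2} cos((k−2)θ), r^k sin(kθ) + kα(r²−R²) r^{k−2} sin((k−2)θ) ) and v^{(e)}(x) := (q/R)^{2k} [ ( r^{−k} cos(kθ), r^{−k} sin(kθ) ) + c₁ k ( (k−2)α(r²−q²) r^{−k} cos(kθ) + r^{−(k−2)} cos((k−2)θ), (k−2)α(r²−q²) r^{−k} sin(kθ) − r^{−(k−2)} sin((k−2)θ) ) ]. Then for every point x = (q cos θ, q sin θ) on the circle ‖x‖ = q, with ν := x/q: (i) v^{(e)}(x) = v^{(f)}(x), and (ii) the jump of the conormal derivative satisfies ∂v^{(e)}/∂ν(x) − ∂v^{(f)}/∂ν(x) = −c₂ k q^k R^{−2k} q²(λ+3μ)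 (cos(kθ), sin(kθ)) + c₂ k q^k R^{−2k} (k−2)(λ+μ)(q²−R²) (cos((k−2)θ), −sin((k−2)θ)), where ∂u/∂ν := λ(∇·u)ν + μ(∇u + (∇u)ᵀ)ν. -/
open Real MeasureTheory

noncomputable section

lemma differentiableAt_of_comp_polarCoord_symm {E : Type*} [NormedAddCommGroup E]
    [NormedSpace ℝ E] {f : ℝ × ℝ → E} {g : ℝ × ℝ → E} {p : ℝ × ℝ} (hp : p.1 ≠ 0)
    (hg : DifferentiableAt ℝ g p)
    (hfg : ∀ᶠ s in nhds p, f (s.1 * cos s.2, s.1 * sin s.2) = g s) :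
    DifferentiableAt ℝ f (p.1 * cos p.2, p.1 * sin p.2) := by
  let Φ : ℝ × ℝ → ℝ × ℝ := fun s => (s.1 * cos s.2, s.1 * sin s.2)
  have hdet : (fderivPolarCoordSymm p).det ≠ 0 := by rwa [det_fderivPolarCoordSymm]
  have hsmooth : ContDiffAt ℝ 1 Φ p := by fun_prop
  have hstrict : HasStrictFDerivAt Φ
      ((fderivPolarCoordSymm p).toContinuousLinearEquivOfDetNeZero hdet : ℝ × ℝ →L[ℝ] ℝ × ℝ) p :=
    hsmooth.hasStrictFDerivAt' (hasFDerivAt_polarCoord_symm p) one_ne_zero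
  have himg : hstrict.localInverse Φ _ p (Φ p) = p := hstrict.localInverse_apply_image
  have hcomp : DifferentiableAt ℝ (g ∘ hstrict.localInverse Φ _ p) (Φ p) :=
    DifferentiableAt.comp _ (by rwa [himg]) hstrict.to_localInverse.hasFDerivAt.differentiableAt
  refine hcomp.congr_of_eventuallyEq ?_
  filter_upwards [hstrict.eventually_right_inverse, hstrict.localInverse_tendsto.eventually hfg]
    with y hy hy'
  exact (congrArg f hy).symm.trans hy'

lemma hasDerivAt_polar_radial {E : Type*} [NormedAddCommGroup E] [NormedSpace ℝ E]
    {f : ℝ × ℝ → E} {q θ : ℝ} (hf : DifferentiableAt ℝ f (q * cos θ, q * sin θ)) :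
    HasDerivAt (fun r => f (r * cos θ, r * sin θ))
      (fderiv ℝ f (q * cos θ, q * sin θ) (cos θ, sin θ)) q := by
  have h : HasDerivAt (fun r : ℝ => (r * cos θ, r * sin θ)) (cos θ, sin θ) q := by
    simpa using ((hasDerivAt_id q).mul_const (cos θ)).prodMk
      ((hasDerivAt_id q).mul_const (sin θ))
  exact hf.hasFDerivAt.comp_hasDerivAt q h

lemma hasDerivAt_polar_angular {E : Type*} [NormedAddCommGroup E] [NormedSpace ℝ E]
    {f : ℝ × ℝ → E} {q θ : ℝ} (hf : DifferentiableAt ℝ f (q * cos θ, q * sin θ)) :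
    HasDerivAt (fun t => f (q * cos t, q * sin t))
      (fderiv ℝ f (q * cos θ, q * sin θ) (-(q * sin θ), q * cos θ)) θ := by
  have h : HasDerivAt (fun t : ℝ => (q * cos t, q * sin t)) (-(q * sin θ), q * cos θ) θ := by
    simpa using ((hasDerivAt_cos θ).const_mul q).prodMk ((hasDerivAt_sin θ).const_mul q)
  exact hf.hasFDerivAt.comp_hasDerivAt θ h

/-- Two fields agreeing on a circle about the origin have equal tangential derivatives there, so
the jump of the conormal derivative is determined by the jump `w` of the radial derivative. -/
lemma trac_sub_trac_of_eq_on_circle (lam mu : ℝ) {u v : ℝ × ℝ → ℝ × ℝ} {q θ : ℝ} (hq : q ≠ 0)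
    (hu : DifferentiableAt ℝ u (q * cos θ, q * sin θ))
    (hv : DifferentiableAt ℝ v (q * cos θ, q * sin θ))
    (huv : ∀ t, u (q * cos t, q * sin t) = v (q * cos t, q * sin t)) {w : ℝ × ℝ}
    (hw : HasDerivAt (fun r => u (r * cos θ, r * sin θ) - v (r * cos θ, r * sin θ)) w q) :
    trac lam mu u (q * cos θ, q * sin θ) (cos θ, sin θ)
        - trac lam mu v (q * cos θ, q * sin θ) (cos θ, sin θ)
      = mu • w + ((lam + mu) * (w.1 * cos θ + w.2 * sin θ)) • (cos θ, sin θ) := by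
  have hrad := hw.unique ((hasDerivAt_polar_radial hu).sub (hasDerivAt_polar_radial hv))
  have hang := (hasDerivAt_polar_angular hu).unique
    ((hasDerivAt_polar_angular hv).congr_of_eventuallyEq (Filter.Eventually.of_forall huv))
  have hlin (L : ℝ × ℝ →L[ℝ] ℝ × ℝ) (a b : ℝ) : L (a, b) = a • L (1, 0) + b • L (0, 1) := by
    rw [← map_smul, ← map_smul, ← map_add]; simp
  have hfst (f : ℝ × ℝ → ℝ × ℝ) (x : ℝ × ℝ) (hf : DifferentiableAt ℝ f x) (y : ℝ × ℝ) :
      fderiv ℝ (fun z => (f z).1) x y = (fderiv ℝ f x y).1 := by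
    rw [hf.hasFDerivAt.fst.fderiv]; rfl
  have hsnd (f : ℝ × ℝ → ℝ × ℝ) (x : ℝ × ℝ) (hf : DifferentiableAt ℝ f x) (y : ℝ × ℝ) :
      fderiv ℝ (fun z => (f z).2) x y = (fderiv ℝ f x y).2 := by
    rw [hf.hasFDerivAt.snd.fderiv]; rfl
  simp only [trac, div2, pdx, pdy, hfst u _ hu, hfst v _ hv, hsnd u _ hu, hsnd v _ hv]
  rw [hlin, hlin (fderiv ℝ v _)] at hrad hang
  generalize fderiv ℝ u _ (1, 0) = ux at *
  generalize fderiv ℝ u _ (0, 1) = uy at *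
  generalize fderiv ℝ v _ (1, 0) = vx at *
  generalize fderiv ℝ v _ (0, 1) = vy at *
  have hcs := cos_sq_add_sin_sq θ
  generalize cos θ = C at *
  generalize sin θ = S at *
  obtain ⟨w₁, w₂⟩ := w
  obtain ⟨ux₁, ux₂⟩ := ux
  obtain ⟨uy₁, uy₂⟩ := uy
  obtain ⟨vx₁, vx₂⟩ := vx
  obtain ⟨vy₁, vy₂⟩ := vy
  simp only [Prod.smul_mk, smul_eq_mul, Prod.mk_add_mk, Prod.mk_sub_mk, Prod.mk.injEq]
    at hrad hang ⊢
  obtain ⟨hr₁, hr₂⟩ := hrad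
  obtain ⟨ha₁, ha₂⟩ := hang
  have hx₁ : ux₁ = vx₁ + w₁ * C := mul_left_cancel₀ hq (by
    linear_combination -q * (ux₁ - vx₁) * hcs - S * ha₁ - q * C * hr₁)
  have hy₁ : uy₁ = vy₁ + w₁ * S := mul_left_cancel₀ hq (by
    linear_combination -q * (uy₁ - vy₁) * hcs + C * ha₁ - q * S * hr₁)
  have hx₂ : ux₂ = vx₂ + w₂ * C := mul_left_cancel₀ hq (by
    linear_combination -q * (ux₂ - vx₂) * hcs - S * ha₂ - q * C * hr₂)
  have hy₂ : uy₂ = vy₂ + w₂ * S := mul_left_cancel₀ hq (by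
    linear_combination -q * (uy₂ - vy₂) * hcs + C * ha₂ - q * S * hr₂)
  subst hx₁ hy₁ hx₂ hy₂
  constructor
  · linear_combination mu * w₁ * hcs
  · linear_combination mu * w₂ * hcs

lemma hasDerivAt_radial_jump {q R α X Y : ℝ} (hq : 0 < q) (hR : 0 < R) {n : ℕ} (hn : n ≠ 0) :
    HasDerivAt (fun r : ℝ =>
      (q / R) ^ (2 * (n + 2)) * (X / r ^ (n + 2)
          + α * (R ^ 2 - q ^ 2) / q ^ 4 * ((n + 2 : ℕ) : ℝ)
            * (n * α * (r ^ 2 - q ^ 2) * X / r ^ (n + 2) + Y / r ^ n))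
        - (r ^ (n + 2) * X - ((n + 2 : ℕ) : ℝ) * α * (r ^ 2 - R ^ 2) * r ^ n * Y)
          / R ^ (2 * (n + 2)))
      (-(2 * (n + 2) * q ^ (n + 1) / R ^ (2 * (n + 2)) * (1 + n * α ^ 2 * (q ^ 2 - R ^ 2) / q ^ 2))
          * X
        + 2 * (n + 2) * α * q ^ (n + 1) / R ^ (2 * (n + 2)) * (1 + n * (q ^ 2 - R ^ 2) / q ^ 2)
          * Y) q := by
  obtain ⟨m, rfl⟩ := Nat.exists_eq_succ_of_ne_zero hn
  have hpow (j : ℕ) := hasDerivAt_pow j q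
  have hdiv (Z : ℝ) (j : ℕ) :=
    (hasDerivAt_const q Z).div (hpow j) (pow_ne_zero j hq.ne')
  have hE := ((hdiv X (m + 1 + 2)).add ((((((hpow 2).sub_const (q ^ 2)).const_mul
    (((m + 1 : ℕ) : ℝ) * α)).mul_const X).div (hpow (m + 1 + 2)) (pow_ne_zero _ hq.ne')).add
    (hdiv Y (m + 1)) |>.const_mul
    (α * (R ^ 2 - q ^ 2) / q ^ 4 * ((m + 1 + 2 : ℕ) : ℝ)))).const_mul
    ((q / R) ^ (2 * (m + 1 + 2)))
  have hF := (((hpow (m + 1 + 2)).mul_const X).sub (((((hpow 2).sub_const (R ^ 2)).const_mul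
    (((m + 1 + 2 : ℕ) : ℝ) * α)).mul (hpow (m + 1))).mul_const Y)).div_const
    (R ^ (2 * (m + 1 + 2)))
  convert! hE.sub hF using 1
  rw [div_pow]
  simp only [Nat.succ_eq_add_one, show m + 1 + 2 - 1 = m + 2 from rfl, Nat.add_sub_cancel, sub_self,
    mul_zero, zero_mul, zero_sub, Nat.cast_add, Nat.cast_one, Nat.cast_ofNat]
  field_simp
  ring

lemma two_mul_cos_add_one_mul_cos (x θ : ℝ) :
    2 * (cos ((x + 1) * θ) * cos θ) = cos ((x + 2) * θ) + cos (x * θ) := by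
  rw [show (x + 2) * θ = (x + 1) * θ + θ by ring, show x * θ = (x + 1) * θ - θ by ring,
    cos_add, cos_sub]
  ring

lemma two_mul_cos_add_one_mul_sin (x θ : ℝ) :
    2 * (cos ((x + 1) * θ) * sin θ) = sin ((x + 2) * θ) - sin (x * θ) := by
  rw [show (x + 2) * θ = (x + 1) * θ + θ by ring, show x * θ = (x + 1) * θ - θ by ring,
    sin_add, sin_sub]
  ring

/-- on the circle ‖x‖ = q the middle part v^{(f)} and exterior part v^{(e)} of the
test field v̂_k agree, and the jump of their conormal derivatives equals the prescribed
combination of the Fourier modes (cos kθ, sin kθ) and (cos (k−2)θ, −sin (k−2)θ). -/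
theorem test_field_jump_on_source_circle (lam mu : ℝ) (hmu : 0 < mu)
    (hlm : 0 < lam + mu) (α : ℝ) (hα : α = (lam + mu) / (lam + 3 * mu))
    (R q : ℝ) (hR : 0 < R) (hq : R < q) (k : ℕ) (hk : 3 ≤ k)
    (c₁ c₂ : ℝ) (hc₁ : c₁ = α * (R ^ 2 - q ^ 2) / q ^ 4)
    (hc₂ : c₂ = 4 * mu * (lam + 2 * mu) / (q ^ 3 * (lam + 3 * mu) ^ 2))
    (vf ve : ℝ × ℝ → ℝ × ℝ)
    (hvf : ∀ r θ : ℝ, 0 ≤ r →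
      vf (r * Real.cos θ, r * Real.sin θ)
        = ((r ^ k * Real.cos ((k : ℝ) * θ)
              - (k : ℝ) * α * (r ^ 2 - R ^ 2) * r ^ (k - 2) * Real.cos (((k : ℝ) - 2) * θ))
                / R ^ (2 * k),
           (r ^ k * Real.sin ((k : ℝ) * θ)
              + (k : ℝ) * α * (r ^ 2 - R ^ 2) * r ^ (k - 2) * Real.sin (((k : ℝ) - 2) * θ))
                / R ^ (2 * k)))
    (hve : ∀ r θ : ℝ, 0 < r →
      ve (r * Real.cos θ, r * Real.sin θ)
        = ((q / R) ^ (2 * k) * (Real.cos ((k : ℝ) * θ) / r ^ k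
              + c₁ * (k : ℝ) * (((k : ℝ) - 2) * α * (r ^ 2 - q ^ 2) * Real.cos ((k : ℝ) * θ) / r ^ k
                + Real.cos (((k : ℝ) - 2) * θ) / r ^ (k - 2))),
           (q / R) ^ (2 * k) * (Real.sin ((k : ℝ) * θ) / r ^ k
              + c₁ * (k : ℝ) * (((k : ℝ) - 2) * α * (r ^ 2 - q ^ 2) * Real.sin ((k : ℝ) * θ) / r ^ k
                - Real.sin (((k : ℝ) - 2) * θ) / r ^ (k - 2))))) :
    ∀ θ : ℝ,
      ve (q * Real.cos θ, q * Real.sin θ) = vf (q * Real.cos θ, q * Real.sin θ)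
      ∧ trac lam mu ve (q * Real.cos θ, q * Real.sin θ) (Real.cos θ, Real.sin θ)
          - trac lam mu vf (q * Real.cos θ, q * Real.sin θ) (Real.cos θ, Real.sin θ)
        = (-(c₂ * (k : ℝ) * q ^ k / R ^ (2 * k) * (q ^ 2 * (lam + 3 * mu))))
              • (Real.cos ((k : ℝ) * θ), Real.sin ((k : ℝ) * θ))
          + (c₂ * (k : ℝ) * q ^ k / R ^ (2 * k) * (((k : ℝ) - 2) * (lam + mu) * (q ^ 2 - R ^ 2)))
              • (Real.cos (((k : ℝ) - 2) * θ), -Real.sin (((k : ℝ) - 2) * θ)) := by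
  obtain ⟨n, rfl⟩ : ∃ n, k = n + 2 := ⟨k - 2, by omega⟩
  have hq0 : 0 < q := hR.trans hq
  have hk2 : ((n + 2 : ℕ) : ℝ) - 2 = n := by push_cast; ring
  simp only [hk2, Nat.add_sub_cancel] at hvf hve ⊢
  have hcircle (t : ℝ) : ve (q * cos t, q * sin t) = vf (q * cos t, q * sin t) := by
    rw [hve q t hq0, hvf q t hq0.le, hc₁, div_pow]
    ext <;> simp only <;> field_simp <;> ring
  intro θ
  refine ⟨hcircle θ, ?_⟩
  have hpos : ∀ᶠ s : ℝ × ℝ in nhds (q, θ), 0 < s.1 :=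
    continuous_fst.continuousAt.eventually (lt_mem_nhds hq0)
  have hdf : DifferentiableAt ℝ vf (q * cos θ, q * sin θ) := by
    refine differentiableAt_of_comp_polarCoord_symm (p := (q, θ)) hq0.ne' ?_
      (hpos.mono fun s hs => hvf s.1 s.2 hs.le)
    fun_prop
  have hde : DifferentiableAt ℝ ve (q * cos θ, q * sin θ) := by
    refine differentiableAt_of_comp_polarCoord_symm (p := (q, θ)) hq0.ne' ?_
      (hpos.mono fun s hs => hve s.1 s.2 hs)
    fun_prop (disch := simp [hq0.ne'])
  have hn : n ≠ 0 := by omega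
  have hw := (hasDerivAt_radial_jump (α := α) (X := cos ((n + 2 : ℕ) * θ)) (Y := cos (n * θ))
    hq0 hR hn).prodMk (hasDerivAt_radial_jump (α := α) (X := sin ((n + 2 : ℕ) * θ))
    (Y := -sin (n * θ)) hq0 hR hn)
  have hjump := trac_sub_trac_of_eq_on_circle lam mu hq0.ne' hde hdf hcircle
    (hw.congr_of_eventuallyEq (by
      filter_upwards [lt_mem_nhds hq0] with r hr
      rw [hve r θ hr, hvf r θ hr.le, hc₁]
      simp only [Prod.mk_sub_mk]
      congr 1
      ring))
  rw [hjump]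
  push_cast
  have hcc := two_mul_cos_add_one_mul_cos n θ
  have hcs := two_mul_cos_add_one_mul_sin n θ
  have hdot₁ : cos ((n + 2) * θ) * cos θ + sin ((n + 2) * θ) * sin θ = cos ((n + 1) * θ) := by
    rw [← cos_sub]; congr 1; ring
  have hdot₂ : cos (n * θ) * cos θ - sin (n * θ) * sin θ = cos ((n + 1) * θ) := by
    rw [← cos_add]; congr 1; ring
  set a := -(2 * ((n : ℝ) + 2) * q ^ (n + 1) / R ^ (2 * (n + 2))
    * (1 + n * α ^ 2 * (q ^ 2 - R ^ 2) / q ^ 2)) with ha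
  set b := 2 * ((n : ℝ) + 2) * α * q ^ (n + 1) / R ^ (2 * (n + 2))
    * (1 + n * (q ^ 2 - R ^ 2) / q ^ 2) with hb
  obtain ⟨L, hL, hL0⟩ : ∃ L, lam + 3 * mu = L ∧ L ≠ 0 := ⟨_, rfl, by linarith⟩
  have hL₁ : lam + mu = L - 2 * mu := by linarith
  have hL₂ : lam + 2 * mu = L - mu := by linarith
  have hA : mu * a + (lam + mu) * (a + b) / 2
      = -(c₂ * (n + 2) * q ^ (n + 2) / R ^ (2 * (n + 2)) * (q ^ 2 * (lam + 3 * mu))) := by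
    rw [ha, hb, hc₂, hα, hL, hL₁, hL₂]
    field_simp
    ring
  have hB : mu * b + (lam + mu) * (a + b) / 2
      = c₂ * (n + 2) * q ^ (n + 2) / R ^ (2 * (n + 2))
        * (n * (lam + mu) * (q ^ 2 - R ^ 2)) := by
    rw [ha, hb, hc₂, hα, hL, hL₁, hL₂]
    field_simp
    ring
  rw [← hA, ← hB]
  ext
  · simp only [Prod.smul_mk, smul_eq_mul, Prod.mk_add_mk]
    linear_combination (lam + mu) * cos θ * (a * hdot₁ + b * hdot₂)
      + (lam + mu) * (a + b) / 2 * hcc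
  · simp only [Prod.smul_mk, smul_eq_mul, Prod.mk_add_mk]
    linear_combination (lam + mu) * sin θ * (a * hdot₁ + b * hdot₂)
      + (lam + mu) * (a + b) / 2 * hcs
end
end

section
/- Let λ, μ ∈ ℝ with μ > 0 and λ + μ > 0, set α := (λ+μ)/(λ+3μ), let 0 < R < q, let k ≥ 3 be an integer, and set c₃ := −(λ+3μ) and c₄ := (λ+μ)(q²−R²). Define in polar coordinates V^{(i)}(x) := (c₃/k) ( r^k cos(kθ) − kα(r²−q²) r^{k−2} cos((k−2)θ), r^k sin(kθ) + kα(r²−q²) r^{k−2} sin((k−2)θ) ) + c₄ ( r^{k−2} cos((k−2)θ), −r^{k−2} sin((k−2)θ) ) and V^{(o)}(x) := c₄ q^{2(k−2)} ( r^{−(k−2)} cos((k−2)θ) + (k−2)α(r²−q²) r^{−k} cos(kθ), −r^{−(k−2)} sin((k−2)θ) + (k−2)α(r²−q²) r^{−k} sin(kθ) ) + (c₃/k) q^{2k} ( r^{−k} cos(kθ), r^{−k} sin(kθ) ). Then μ ΔV^{(i)} + (λ+μ)∇(∇·V^{(i)}) = 0 at every point of ℝ², and μ ΔV^{(o)} +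 (λ+μ)∇(∇·V^{(o)}) = 0 at every point of ℝ² \ {0}. -/
open Real MeasureTheory

noncomputable section

/-- `f` is differentiable at `x` with partial derivatives `a` and `b`. -/
def HasGrad (f : ℝ × ℝ → ℝ) (a b : ℝ) (x : ℝ × ℝ) : Prop :=
  HasFDerivAt f (a • ContinuousLinearMap.fst ℝ ℝ ℝ + b • ContinuousLinearMap.snd ℝ ℝ ℝ) x

namespace HasGrad

variable {f g : ℝ × ℝ → ℝ} {a b a' b' : ℝ} {x : ℝ × ℝ}

theorem pdx_eq (h : HasGrad f a b x) : pdx f x = a := by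
  rw [pdx, HasFDerivAt.fderiv h]; simp

theorem pdy_eq (h : HasGrad f a b x) : pdy f x = b := by
  rw [pdy, HasFDerivAt.fderiv h]; simp

theorem add (hf : HasGrad f a b x) (hg : HasGrad g a' b' x) :
    HasGrad (fun y => f y + g y) (a + a') (b + b') x := by
  refine (HasFDerivAt.fun_add hf hg).congr_fderiv ?_
  module

theorem sub (hf : HasGrad f a b x) (hg : HasGrad g a' b' x) :
    HasGrad (fun y => f y - g y) (a - a') (b - b') x := by
  refine (HasFDerivAt.fun_sub hf hg).congr_fderiv ?_
  module

theorem const_mul (c : ℝ) (hf : HasGrad f a b x) :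
    HasGrad (fun y => c * f y) (c * a) (c * b) x := by
  refine (HasFDerivAt.const_mul hf c).congr_fderiv ?_
  module

theorem mul (hf : HasGrad f a b x) (hg : HasGrad g a' b' x) :
    HasGrad (fun y => f y * g y) (f x * a' + g x * a) (f x * b' + g x * b) x := by
  refine (HasFDerivAt.fun_mul hf hg).congr_fderiv ?_
  module

theorem coord_fst (x : ℝ × ℝ) : HasGrad (fun y => y.1) 1 0 x := by
  refine (hasFDerivAt_fst (𝕜 := ℝ) (p := x)).congr_fderiv ?_
  module

theorem coord_snd (x : ℝ × ℝ) : HasGrad (fun y => y.2) 0 1 x := by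
  refine (hasFDerivAt_snd (𝕜 := ℝ) (p := x)).congr_fderiv ?_
  module

theorem congr_grad (h : HasGrad f a b x) (ha : a = a') (hb : b = b') : HasGrad f a' b' x :=
  ha ▸ hb ▸ h

theorem congr_on {U : Set (ℝ × ℝ)} (h : HasGrad f a b x) (hU : IsOpen U) (hx : x ∈ U)
    (hfg : ∀ y ∈ U, g y = f y) : HasGrad g a b x :=
  HasFDerivAt.congr_of_eventuallyEq h (Filter.eventually_of_mem (hU.mem_nhds hx) hfg)

end HasGrad

theorem lap2_eq_of_hasGrad {f fx fy : ℝ × ℝ → ℝ} {U : Set (ℝ × ℝ)} (hU : IsOpen U)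
    (hf : ∀ y ∈ U, HasGrad f (fx y) (fy y) y) {x : ℝ × ℝ} (hx : x ∈ U) {a b c d : ℝ}
    (hfx : HasGrad fx a b x) (hfy : HasGrad fy c d x) : lap2 f x = a + d := by
  rw [lap2, (hfx.congr_on hU hx fun y hy => (hf y hy).pdx_eq).pdx_eq,
    (hfy.congr_on hU hx fun y hy => (hf y hy).pdy_eq).pdy_eq]

/-- The point of the complex plane with the given coordinates. -/
def toC (x : ℝ × ℝ) : ℂ := x.1 + x.2 * Complex.I

/-- The real part of the `n`-th power of `x₁ + i x₂`. -/
def powRe (n : ℤ) (x : ℝ × ℝ) : ℝ := (toC x ^ n).re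

/-- The imaginary part of the `n`-th power of `x₁ + i x₂`. -/
def powIm (n : ℤ) (x : ℝ × ℝ) : ℝ := (toC x ^ n).im

theorem hasFDerivAt_toC_zpow (n : ℤ) {x : ℝ × ℝ} (h : toC x ≠ 0 ∨ 0 ≤ n) :
    HasFDerivAt (fun y => toC y ^ n)
      ((n * toC x ^ (n - 1)) • (Complex.equivRealProdCLM.symm : ℝ × ℝ →L[ℝ] ℂ)) x := by
  have hC : HasFDerivAt toC (Complex.equivRealProdCLM.symm : ℝ × ℝ →L[ℝ] ℂ) x := by
    refine Complex.equivRealProdCLM.symm.hasFDerivAt.congr_of_eventuallyEq (.of_forall fun y => ?_)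
    simp [toC, Complex.ext_iff]
  exact (hasDerivAt_zpow n (toC x) h).comp_hasFDerivAt x hC

theorem hasGrad_powRe (n : ℤ) {x : ℝ × ℝ} (h : toC x ≠ 0 ∨ 0 ≤ n) :
    HasGrad (powRe n) (n * powRe (n - 1) x) (-(n * powIm (n - 1) x)) x := by
  refine (Complex.reCLM.hasFDerivAt.comp x (hasFDerivAt_toC_zpow n h)).congr_fderiv ?_
  ext <;> simp [powRe, powIm]

theorem hasGrad_powIm (n : ℤ) {x : ℝ × ℝ} (h : toC x ≠ 0 ∨ 0 ≤ n) :
    HasGrad (powIm n) (n * powIm (n - 1) x) (n * powRe (n - 1) x) x := by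
  refine (Complex.imCLM.hasFDerivAt.comp x (hasFDerivAt_toC_zpow n h)).congr_fderiv ?_
  ext <;> simp [powRe, powIm]

theorem toC_polar_zpow (r θ : ℝ) (n : ℤ) :
    toC (r * Real.cos θ, r * Real.sin θ) ^ n
      = ((r ^ n : ℝ) : ℂ) * (Real.cos (n * θ) + Real.sin (n * θ) * Complex.I) := by
  have h : toC (r * Real.cos θ, r * Real.sin θ) = r * Complex.exp (θ * Complex.I) := by
    rw [Complex.exp_mul_I, toC]; push_cast; ring
  rw [h, mul_zpow, ← Complex.exp_int_mul, ← mul_assoc]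
  push_cast
  rw [Complex.exp_mul_I]

theorem powRe_polar (n : ℤ) (r θ : ℝ) :
    powRe n (r * Real.cos θ, r * Real.sin θ) = r ^ n * Real.cos (n * θ) := by
  rw [powRe, toC_polar_zpow, Complex.re_ofReal_mul]; simp [-Complex.ofReal_cos, -Complex.ofReal_sin]

theorem powIm_polar (n : ℤ) (r θ : ℝ) :
    powIm n (r * Real.cos θ, r * Real.sin θ) = r ^ n * Real.sin (n * θ) := by
  rw [powIm, toC_polar_zpow, Complex.im_ofReal_mul]; simp [-Complex.ofReal_cos, -Complex.ofReal_sin]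

theorem exists_polar (x : ℝ × ℝ) :
    ∃ r θ : ℝ, 0 ≤ r ∧ x = (r * Real.cos θ, r * Real.sin θ) := by
  refine ⟨‖toC x‖, (toC x).arg, norm_nonneg _, ?_⟩
  rw [Complex.norm_mul_cos_arg, Complex.norm_mul_sin_arg]
  simp [toC]

theorem toC_ne_zero {x : ℝ × ℝ} (hx : x ≠ 0) : toC x ≠ 0 := by
  intro h
  apply hx
  simpa [toC, Complex.ext_iff, Prod.ext_iff] using h

/-- The field `A (zⁿ - nα z z̄ⁿ⁻¹) + B z̄ⁿ⁻²` in complex notation. -/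
def planarMode (α A B : ℝ) (n : ℤ) (x : ℝ × ℝ) : ℝ × ℝ :=
  (A * (powRe n x - n * α * (x.1 * powRe (n - 1) x + x.2 * powIm (n - 1) x))
      + B * powRe (n - 2) x,
    A * (powIm n x - n * α * (x.2 * powRe (n - 1) x - x.1 * powIm (n - 1) x))
      - B * powIm (n - 2) x)

theorem lame2_eq_zero_of_eq_planarMode {lam mu α : ℝ} (hα : α * (lam + 3 * mu) = lam + mu)
    (A B : ℝ) (n : ℤ) {U : Set (ℝ × ℝ)} (hU : IsOpen U) (hn : ∀ x ∈ U, toC x ≠ 0 ∨ 3 ≤ n)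
    {u : ℝ × ℝ → ℝ × ℝ} (hu : ∀ x ∈ U, u x = planarMode α A B n x) {x : ℝ × ℝ} (hx : x ∈ U) :
    lame2 lam mu u x = (0, 0) := by
  have hRe (m : ℤ) (hm : n - 3 ≤ m) (y) (hy : y ∈ U) :=
    hasGrad_powRe m ((hn y hy).imp_right fun h => (by lia : 0 ≤ m))
  have hIm (m : ℤ) (hm : n - 3 ≤ m) (y) (hy : y ∈ U) :=
    hasGrad_powIm m ((hn y hy).imp_right fun h => (by lia : 0 ≤ m))
  have e1 : n - 1 - 1 = n - 2 := by ring
  have e2 : n - 2 - 1 = n - 3 := by ring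
  have R0 (y) (hy : y ∈ U) := hRe n (by lia) y hy
  have I0 (y) (hy : y ∈ U) := hIm n (by lia) y hy
  have R1 (y) (hy : y ∈ U) := hRe (n - 1) (by lia) y hy
  have I1 (y) (hy : y ∈ U) := hIm (n - 1) (by lia) y hy
  have R2 (y) (hy : y ∈ U) := hRe (n - 2) (by lia) y hy
  have I2 (y) (hy : y ∈ U) := hIm (n - 2) (by lia) y hy
  have R3 := hRe (n - 3) le_rfl x hx
  have I3 := hIm (n - 3) le_rfl x hx
  simp only [e1, e2] at R1 I1 R2 I2
  have X (y) := HasGrad.coord_fst y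
  have Y (y) := HasGrad.coord_snd y
  have hu1 (y) (hy : y ∈ U) := (((((R0 y hy).sub ((((X y).mul (R1 y hy)).add
    ((Y y).mul (I1 y hy))).const_mul (n * α))).const_mul A).add
    ((R2 y hy).const_mul B)).congr_on hU hy fun z hz => congrArg Prod.fst (hu z hz)).congr_grad
    (a' := A * (n * powRe (n - 1) y - n * α * (powRe (n - 1) y
      + (n - 1 : ℤ) * (y.1 * powRe (n - 2) y + y.2 * powIm (n - 2) y)))
      + B * (n - 2 : ℤ) * powRe (n - 3) y)
    (b' := A * (-(n * powIm (n - 1) y) - n * α * (powIm (n - 1) y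
      + (n - 1 : ℤ) * (y.2 * powRe (n - 2) y - y.1 * powIm (n - 2) y)))
      - B * (n - 2 : ℤ) * powIm (n - 3) y) (by ring) (by ring)
  have hu2 (y) (hy : y ∈ U) := (((((I0 y hy).sub ((((Y y).mul (R1 y hy)).sub
    ((X y).mul (I1 y hy))).const_mul (n * α))).const_mul A).sub
    ((I2 y hy).const_mul B)).congr_on hU hy fun z hz => congrArg Prod.snd (hu z hz)).congr_grad
    (a' := A * (n * powIm (n - 1) y - n * α * ((n - 1 : ℤ)
      * (y.2 * powRe (n - 2) y - y.1 * powIm (n - 2) y) - powIm (n - 1) y))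
      - B * (n - 2 : ℤ) * powIm (n - 3) y)
    (b' := A * (n * powRe (n - 1) y - n * α * (powRe (n - 1) y
      - (n - 1 : ℤ) * (y.1 * powRe (n - 2) y + y.2 * powIm (n - 2) y)))
      - B * (n - 2 : ℤ) * powRe (n - 3) y) (by ring) (by ring)
  have hdiv : HasGrad (fun y => div2 u y) _ _ x :=
    ((R1 x hx).const_mul (2 * A * n * (1 - α))).congr_on hU hx fun y hy => by
      rw [div2, (hu1 y hy).pdx_eq, (hu2 y hy).pdy_eq]; ring
  have hxRyI := ((X x).mul (R2 x hx)).add ((Y x).mul (I2 x hx))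
  have hyRxI := ((Y x).mul (R2 x hx)).sub ((X x).mul (I2 x hx))
  have R1' := (R1 x hx).const_mul n
  have I1' := (I1 x hx).const_mul n
  have hlap1 : lap2 (fun y => (u y).1) x = -4 * A * n * (n - 1 : ℤ) * α * powRe (n - 2) x := by
    rw [lap2_eq_of_hasGrad hU hu1 hx
      (((R1'.sub (((R1 x hx).add (hxRyI.const_mul (n - 1 : ℤ))).const_mul (n * α))).const_mul
        A).add (R3.const_mul (B * (n - 2 : ℤ))))
      (((((I1'.const_mul (-1)).congr_on hU hx fun y _ => (neg_one_mul _).symm).sub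
        (((I1 x hx).add (hyRxI.const_mul (n - 1 : ℤ))).const_mul (n * α))).const_mul
        A).sub (I3.const_mul (B * (n - 2 : ℤ))))]
    ring
  have hlap2 : lap2 (fun y => (u y).2) x = 4 * A * n * (n - 1 : ℤ) * α * powIm (n - 2) x := by
    rw [lap2_eq_of_hasGrad hU hu2 hx
      (((I1'.sub (((hyRxI.const_mul (n - 1 : ℤ)).sub (I1 x hx)).const_mul (n * α))).const_mul
        A).sub (I3.const_mul (B * (n - 2 : ℤ))))
      (((R1'.sub (((R1 x hx).sub (hxRyI.const_mul (n - 1 : ℤ))).const_mul (n * α))).const_mul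
        A).sub (R3.const_mul (B * (n - 2 : ℤ))))]
    ring
  rw [lame2, hlap1, hlap2, hdiv.pdx_eq, hdiv.pdy_eq, Prod.mk.injEq]
  constructor
  · linear_combination (-2 * A * n * (n - 1 : ℤ) * powRe (n - 2) x) * hα
  · linear_combination (2 * A * n * (n - 1 : ℤ) * powIm (n - 2) x) * hα

theorem planarMode_polar (α A B : ℝ) (n : ℤ) (r θ : ℝ) :
    planarMode α A B n (r * Real.cos θ, r * Real.sin θ)
      = (A * (r ^ n * Real.cos (n * θ) - n * α * (r * r ^ (n - 1)) * Real.cos ((n - 2) * θ))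
          + B * (r ^ (n - 2) * Real.cos ((n - 2) * θ)),
        A * (r ^ n * Real.sin (n * θ) + n * α * (r * r ^ (n - 1)) * Real.sin ((n - 2) * θ))
          - B * (r ^ (n - 2) * Real.sin ((n - 2) * θ))) := by
  have e : ((n : ℝ) - 2) * θ = (n - 1) * θ - θ := by ring
  have hc : Real.cos ((n - 2) * θ)
      = Real.cos ((n - 1) * θ) * Real.cos θ + Real.sin ((n - 1) * θ) * Real.sin θ := by
    rw [e, Real.cos_sub]
  have hs : Real.sin ((n - 2) * θ)
      = Real.sin ((n - 1) * θ) * Real.cos θ - Real.cos ((n - 1) * θ) * Real.sin θ := by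
    rw [e, Real.sin_sub]
  simp only [planarMode, powRe_polar, powIm_polar, Int.cast_sub, Int.cast_one, Int.cast_ofNat]
  rw [Prod.mk.injEq]
  constructor
  · linear_combination (n * α * A * (r * r ^ (n - 1))) * hc
  · linear_combination (-n * α * A * (r * r ^ (n - 1))) * hs

/-- the interior part V^{(i)} of the high-frequency test field V̂_k satisfies the
Lamé equation on all of ℝ², and the exterior part V^{(o)} satisfies it on ℝ² \ {0}. -/
theorem high_frequency_test_fields_satisfy_lame (lam mu : ℝ) (hmu : 0 < mu)
    (hlm : 0 < lam + mu) (α : ℝ) (hα : α = (lam + mu) / (lam + 3 * mu))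
    (R q : ℝ) (hR : 0 < R) (hq : R < q) (k : ℕ) (hk : 3 ≤ k)
    (c₃ c₄ : ℝ) (hc₃ : c₃ = -(lam + 3 * mu)) (hc₄ : c₄ = (lam + mu) * (q ^ 2 - R ^ 2))
    (Vi Vo : ℝ × ℝ → ℝ × ℝ)
    (hVi : ∀ r θ : ℝ, 0 ≤ r →
      Vi (r * Real.cos θ, r * Real.sin θ)
        = ((c₃ / (k : ℝ)) * (r ^ k * Real.cos ((k : ℝ) * θ)
              - (k : ℝ) * α * (r ^ 2 - q ^ 2) * r ^ (k - 2) * Real.cos (((k : ℝ) - 2) * θ))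
            + c₄ * (r ^ (k - 2) * Real.cos (((k : ℝ) - 2) * θ)),
           (c₃ / (k : ℝ)) * (r ^ k * Real.sin ((k : ℝ) * θ)
              + (k : ℝ) * α * (r ^ 2 - q ^ 2) * r ^ (k - 2) * Real.sin (((k : ℝ) - 2) * θ))
            + c₄ * (-(r ^ (k - 2) * Real.sin (((k : ℝ) - 2) * θ)))))
    (hVo : ∀ r θ : ℝ, 0 < r →
      Vo (r * Real.cos θ, r * Real.sin θ)
        = (c₄ * q ^ (2 * (k - 2)) * (Real.cos (((k : ℝ) - 2) * θ) / r ^ (k - 2)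
              + ((k : ℝ) - 2) * α * (r ^ 2 - q ^ 2) * Real.cos ((k : ℝ) * θ) / r ^ k)
            + (c₃ / (k : ℝ)) * q ^ (2 * k) * (Real.cos ((k : ℝ) * θ) / r ^ k),
           c₄ * q ^ (2 * (k - 2)) * (-(Real.sin (((k : ℝ) - 2) * θ) / r ^ (k - 2))
              + ((k : ℝ) - 2) * α * (r ^ 2 - q ^ 2) * Real.sin ((k : ℝ) * θ) / r ^ k)
            + (c₃ / (k : ℝ)) * q ^ (2 * k) * (Real.sin ((k : ℝ) * θ) / r ^ k))) :
    (∀ x : ℝ × ℝ, lame2 lam mu Vi x = (0, 0))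
    ∧ (∀ x : ℝ × ℝ, x ≠ 0 → lame2 lam mu Vo x = (0, 0)) := by
  have hα' : α * (lam + 3 * mu) = lam + mu := by
    rw [hα, div_mul_cancel₀ _ (by linarith)]
  obtain ⟨m, rfl⟩ : ∃ m, k = m + 2 := ⟨k - 2, by lia⟩
  have hk0 : ((m + 2 : ℕ) : ℝ) ≠ 0 := by positivity
  simp only [Nat.add_sub_cancel] at hVi hVo
  constructor
  · intro x
    refine lame2_eq_zero_of_eq_planarMode hα' (c₃ / (m + 2 : ℕ)) (c₃ * α * q ^ 2 + c₄)
      (m + 2 : ℕ) isOpen_univ (fun y _ => .inr (by exact_mod_cast hk)) (fun y _ => ?_)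
      (Set.mem_univ x)
    obtain ⟨r, θ, hr, rfl⟩ := exists_polar y
    have e1 : ((m + 2 : ℕ) : ℤ) - 1 = (m + 1 : ℕ) := by push_cast; ring
    have e2 : ((m + 2 : ℕ) : ℤ) - 2 = m := by push_cast; ring
    rw [hVi r θ hr, planarMode_polar, e1, e2]
    simp only [zpow_natCast, Int.cast_natCast]
    rw [Prod.mk.injEq]
    constructor <;> field_simp <;> ring
  · intro x hx
    refine lame2_eq_zero_of_eq_planarMode hα' (c₄ * q ^ (2 * m))
      (c₃ / (m + 2 : ℕ) * q ^ (2 * (m + 2)) - c₄ * q ^ (2 * m) * m * α * q ^ 2)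
      (-m) (isOpen_compl_singleton (x := (0 : ℝ × ℝ))) (fun y hy => .inl (toC_ne_zero hy))
      (fun y hy => ?_) hx
    obtain ⟨r, θ, hr, rfl⟩ := exists_polar y
    have hr0 : r ≠ 0 := by
      rintro rfl
      exact hy (by simp)
    have e1 : -(m : ℤ) - 1 = -((m + 1 : ℕ) : ℤ) := by push_cast; ring
    have e2 : -(m : ℤ) - 2 = -((m + 2 : ℕ) : ℤ) := by push_cast; ring
    have e3 : (-(m : ℝ) - 2) * θ = -(((m + 2 : ℕ) : ℝ) * θ) := by push_cast; ring
    have e4 : ((m + 2 : ℕ) : ℝ) - 2 = m := by push_cast; ring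
    rw [hVo r θ (hr.lt_of_ne' hr0), planarMode_polar, e1, e2, e4]
    simp only [zpow_neg, zpow_natCast, Int.cast_neg, Int.cast_natCast, e3, neg_mul, Real.cos_neg,
      Real.sin_neg]
    rw [Prod.mk.injEq]
    constructor <;> field_simp <;> ring
end
end
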